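/- Let (X,d_X) and (Y,d_Y) be complete metric spaces, each with at least two points, and suppose T : U(X,d_X) → U(Y,d_Y) is a bijective sup-metric isometry. Then there exists a uniform homeomorphism ϕ : Y → X such that T(d)(x,y) = d(ϕ(x), ϕ(y)) for every d ∈ U(X,d_X) and all x,y ∈ Y; in particular X and Y are uniformly homeomorphic. -/

import Mathlib

open Set Filter

namespace BanachStone

/-- `d` is a pseudometric. -/
def IsPseudometric {Z : Type*} (d : Z → Z → ℝ) : Prop :=
  (∀ z, d z z = 0) ∧ (∀ z w, d z w = d w z) ∧ (∀ z w v, d z v ≤ d z w + d w v)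

/-- `d` is bounded. -/
def IsBoundedPM {Z : Type*} (d : Z → Z → ℝ) : Prop := ∃ C : ℝ, ∀ z w, d z w ≤ C

/-- The sup-norm of `d`. -/
noncomputable def supNorm {Z : Type*} (d : Z → Z → ℝ) : ℝ := ⨆ p : Z × Z, d p.1 p.2

/-- The sup-metric between `d` and `ρ`. -/
noncomputable def supDist {Z : Type*} (d ρ : Z → Z → ℝ) : ℝ :=
  ⨆ p : Z × Z, |d p.1 p.2 - ρ p.1 p.2|

/-- `PM Z`: bounded continuous pseudometrics on `Z`. -/
def PM (Z : Type*) [TopologicalSpace Z] : Set (Z → Z → ℝ) :=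
  {d | IsPseudometric d ∧ IsBoundedPM d ∧ Continuous fun p : Z × Z => d p.1 p.2}

/-- The topology induced by `d` (generated by open `d`-balls). -/
def metricTopology {Z : Type*} (d : Z → Z → ℝ) : TopologicalSpace Z :=
  TopologicalSpace.generateFrom {s | ∃ z : Z, ∃ r : ℝ, s = {w | d z w < r}}

/-- `AM Z`: admissible metrics, i.e. bounded metrics inducing the topology of `Z`. -/
def AM (Z : Type*) [t : TopologicalSpace Z] : Set (Z → Z → ℝ) :=
  {d | IsPseudometric d ∧ IsBoundedPM d ∧ (∀ z w : Z, z ≠ w → 0 < d z w) ∧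
    metricTopology d = t}

/-- `Pp Z`: elements of `PM Z` attaining the sup-norm at exactly one unordered pair
of distinct points. -/
def Pp (Z : Type*) [TopologicalSpace Z] : Set (Z → Z → ℝ) :=
  {d | d ∈ PM Z ∧ ∃ z w : Z, z ≠ w ∧ d z w = supNorm d ∧
    ∀ z' w' : Z, z' ≠ w' → d z' w' = supNorm d → ({z', w'} : Set Z) = {z, w}}

/-- `UPM Z`: bounded pseudometrics uniformly continuous w.r.t. the uniformity of `Z`. -/
def UPM (Z : Type*) [UniformSpace Z] : Set (Z → Z → ℝ) :=
  {d | IsPseudometric d ∧ IsBoundedPM d ∧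
    ∀ ε : ℝ, 0 < ε → ∃ U ∈ uniformity Z, ∀ x y : Z, (x, y) ∈ U → d x y < ε}

/-- `UC Z`: bounded uniformly continuous real-valued functions on `Z`. -/
def UC (Z : Type*) [UniformSpace Z] : Set (Z → ℝ) :=
  {f | (∃ C : ℝ, ∀ z, |f z| ≤ C) ∧ UniformContinuous f}

/-- The space `U(Z)`. -/
def Ucal (Z : Type*) [UniformSpace Z] : Set (Z → Z → ℝ) :=
  {d | d ∈ PM Z ∧ ∀ ε : ℝ, 0 < ε → ∃ F : Finset (Z → ℝ), F.Nonempty ∧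
    (↑F : Set (Z → ℝ)) ⊆ UC Z ∧ ∃ δ : ℝ, 0 < δ ∧
    ∀ x y : Z, (∀ f ∈ F, |f x - f y| < δ) → d x y < ε}

/-- The uniformity filter of the coarsest uniformity on `Z` making every bounded
uniformly continuous real-valued function on `Z` uniformly continuous. -/
noncomputable def U0 (Z : Type*) [UniformSpace Z] : Filter (Z × Z) :=
  ⨅ f ∈ UC Z, Filter.comap (fun p : Z × Z => (f p.1, f p.2)) (uniformity ℝ)

/-- The Lipschitz constant of a pseudometric on a metric space. -/
noncomputable def lip {Z : Type*} [PseudoMetricSpace Z] (d : Z → Z → ℝ) : ENNReal :=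
  ⨆ (x : Z) (y : Z) (_ : x ≠ y), ENNReal.ofReal (d x y / dist x y)

/-- `LPM Z`: bounded Lipschitz continuous pseudometrics on `Z`. -/
def LPM (Z : Type*) [MetricSpace Z] : Set (Z → Z → ℝ) :=
  {d | IsPseudometric d ∧ IsBoundedPM d ∧ lip d < ⊤}

/-- `LPM_k Z`: elements of `LPM Z` with Lipschitz constant `< k`. -/
def LPMlt (k : ℝ) (Z : Type*) [MetricSpace Z] : Set (Z → Z → ℝ) :=
  {d | d ∈ LPM Z ∧ lip d < ENNReal.ofReal k}

/-- `\overline{LPM}_k Z`: elements of `LPM Z` with Lipschitz constant `≤ k`. -/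
def LPMle (k : ℝ) (Z : Type*) [MetricSpace Z] : Set (Z → Z → ℝ) :=
  {d | d ∈ LPM Z ∧ lip d ≤ ENNReal.ofReal k}

/-- `Z` has exactly two points. -/
def ExactlyTwo (Z : Type*) : Prop := ∃ a b : Z, a ≠ b ∧ ∀ c : Z, c = a ∨ c = b

/-- The two-element subsets of `Z`. -/
def Dset (Z : Type*) : Set (Set Z) := {s | ∃ a b : Z, a ≠ b ∧ s = {a, b}}

open Topology

section Functions

variable {Z : Type*} [MetricSpace Z]

theorem UC.add {f g : Z → ℝ} (hf : f ∈ UC Z) (hg : g ∈ UC Z) :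
    (fun z => f z + g z) ∈ UC Z := by
  obtain ⟨⟨C, hC⟩, hf⟩ := hf
  obtain ⟨⟨D, hD⟩, hg⟩ := hg
  exact ⟨⟨C + D, fun z => (abs_add_le _ _).trans (add_le_add (hC z) (hD z))⟩, hf.add hg⟩

theorem UC.const_mul {f : Z → ℝ} (c : ℝ) (hf : f ∈ UC Z) : (fun z => c * f z) ∈ UC Z := by
  obtain ⟨⟨C, hC⟩, hf⟩ := hf
  refine ⟨⟨|c| * C, fun z => ?_⟩, hf.const_smul c⟩
  rw [abs_mul]
  exact mul_le_mul_of_nonneg_left (hC z) (abs_nonneg c)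

theorem UC.sq {f : Z → ℝ} (hf : f ∈ UC Z) : (fun z => f z ^ 2) ∈ UC Z := by
  obtain ⟨⟨C, hC⟩, hf⟩ := hf
  refine ⟨⟨C ^ 2, fun z => ?_⟩, ?_⟩
  · rw [abs_pow]
    exact pow_le_pow_left₀ (abs_nonneg _) (hC z) 2
  · rw [Metric.uniformContinuous_iff] at hf ⊢
    intro ε hε
    obtain ⟨δ, hδ, h⟩ := hf (ε / (2 * |C| + 1)) (by positivity)
    refine ⟨δ, hδ, fun {a b} hab => ?_⟩
    have h1 := h hab
    rw [Real.dist_eq] at h1 ⊢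
    rw [lt_div_iff₀ (by positivity)] at h1
    have h2 : |f a + f b| ≤ 2 * |C| + 1 := by
      have := abs_add_le (f a) (f b)
      have := hC a
      have := hC b
      have := le_abs_self C
      linarith
    calc |f a ^ 2 - f b ^ 2| = |f a - f b| * |f a + f b| := by rw [← abs_mul]; ring_nf
      _ ≤ |f a - f b| * (2 * |C| + 1) := mul_le_mul_of_nonneg_left h2 (abs_nonneg _)
      _ < ε := h1

theorem UC.const (c : ℝ) : (fun _ : Z => c) ∈ UC Z :=
  ⟨⟨|c|, fun _ => le_rfl⟩, uniformContinuous_const⟩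

theorem UC.min_const {f : Z → ℝ} (hf : UniformContinuous f) (h0 : ∀ z, 0 ≤ f z) {c : ℝ}
    (hc : 0 ≤ c) : (fun z => min (f z) c) ∈ UC Z := by
  refine ⟨⟨c, fun z => ?_⟩, (LipschitzWith.id.min_const c).uniformContinuous.comp hf⟩
  rw [abs_of_nonneg (le_min (h0 z) hc)]
  exact min_le_right _ _

/-- The tent function of radius `r` centred at `x`. -/
noncomputable def bump (x : Z) (r : ℝ) (z : Z) : ℝ := max 0 (1 - dist z x / r)

theorem bump_self (x : Z) (r : ℝ) : bump x r x = 1 := by simp [bump]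

theorem bump_nonneg (x : Z) (r : ℝ) (z : Z) : 0 ≤ bump x r z := le_max_left _ _

theorem bump_le_one (x : Z) {r : ℝ} (hr : 0 < r) (z : Z) : bump x r z ≤ 1 := by
  refine max_le zero_le_one ?_
  have : 0 ≤ dist z x / r := by positivity
  linarith

theorem bump_eq_zero {x z : Z} {r : ℝ} (hr : 0 < r) (h : r ≤ dist z x) : bump x r z = 0 := by
  refine max_eq_left ?_
  have : 1 ≤ dist z x / r := (one_le_div hr).2 h
  linarith

theorem dist_le_of_le_bump {x z : Z} {r η : ℝ} (hr : 0 < r) (hη : η < 1)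
    (h : 1 - η ≤ bump x r z) : dist z x ≤ η * r := by
  rcases le_max_iff.1 h with h | h
  · linarith
  · rw [← div_le_iff₀ hr]
    linarith

theorem bump_mem_UC (x : Z) {r : ℝ} (hr : 0 < r) : bump x r ∈ UC Z := by
  refine ⟨⟨1, fun z => ?_⟩, ?_⟩
  · rw [abs_of_nonneg (bump_nonneg x r z)]
    exact bump_le_one x hr z
  · refine (LipschitzWith.id.const_max 0).uniformContinuous.comp
      (uniformContinuous_const.sub ?_)
    simp only [div_eq_inv_mul]
    exact (uniformContinuous_id.dist (uniformContinuous_const (b := x))).const_smul r⁻¹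

theorem exists_UC_eqOn_finset (g : Z → ℝ) (W : Finset Z) :
    ∃ f ∈ UC Z, ∀ w ∈ W, f w = g w := by
  classical
  induction W using Finset.induction_on with
  | empty => exact ⟨_, UC.const 0, by simp⟩
  | insert a W ha ih =>
    obtain ⟨f, hf, hfg⟩ := ih
    have hW : (↑W : Set Z)ᶜ ∈ 𝓝 a := W.finite_toSet.isClosed.isOpen_compl.mem_nhds ha
    obtain ⟨r, hr, hball⟩ := Metric.mem_nhds_iff.1 hW
    refine ⟨_, UC.add hf (UC.const_mul (g a - f a) (bump_mem_UC a hr)), fun w hw => ?_⟩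
    rcases Finset.mem_insert.1 hw with rfl | hw
    · simp [bump_self]
    · have : r ≤ dist w a := by
        by_contra! h
        exact hball h hw
      simp [bump_eq_zero hr this, hfg w hw]

/-- Efremovich's lemma: bounded uniformly continuous functions detect whether two sequences
are asymptotic. -/
theorem tendsto_dist_of_UC {a b : ℕ → Z}
    (h : ∀ f ∈ UC Z, Tendsto (fun n => f (a n) - f (b n)) atTop (𝓝 0)) :
    Tendsto (fun n => dist (a n) (b n)) atTop (𝓝 0) := by
  by_contra hcon
  obtain ⟨ε, hε, hfreq⟩ : ∃ ε > 0, ∃ᶠ n in atTop, ε ≤ dist (a n) (b n) := by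
    by_contra! h'
    refine hcon (Metric.tendsto_nhds.2 fun ε hε => ?_)
    have := h' ε hε
    simpa [not_frequently, abs_of_nonneg] using this
  obtain ⟨s, hs, hsε⟩ := extraction_of_frequently_atTop hfreq
  have hsub : ∀ f ∈ UC Z, ∀ δ > 0, ∀ᶠ n in atTop, |f (a (s n)) - f (b (s n))| < δ := by
    intro f hf δ hδ
    have := (Metric.tendsto_nhds.1 ((h f hf).comp hs.tendsto_atTop)) δ hδ
    simpa [Real.dist_eq] using this
  have hfar : ∀ p : Z, ∀ᶠ n in atTop, ε / 4 ≤ dist (a (s n)) p ∧ ε / 4 ≤ dist (b (s n)) p := by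
    intro p
    have hp : (fun z => min (dist z p) ε) ∈ UC Z :=
      UC.min_const (uniformContinuous_id.dist uniformContinuous_const) (fun _ => dist_nonneg) hε.le
    filter_upwards [hsub _ hp (ε / 2) (by positivity)] with n hn
    have h1 := hsε n
    have h2 := dist_triangle_right (a (s n)) (b (s n)) p
    rw [abs_lt] at hn
    constructor
    · by_contra! hlt
      have h3 : min (dist (a (s n)) p) ε ≤ dist (a (s n)) p := min_le_left _ _
      have h4 : 3 * ε / 4 ≤ min (dist (b (s n)) p) ε := le_min (by linarith) (by linarith)
      linarith
    · by_contra! hlt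
      have h3 : min (dist (b (s n)) p) ε ≤ dist (b (s n)) p := min_le_left _ _
      have h4 : 3 * ε / 4 ≤ min (dist (a (s n)) p) ε := le_min (by linarith) (by linarith)
      linarith
  obtain ⟨t, -, ht⟩ := exists_seq_of_forall_finset_exists (fun _ : ℕ => True)
    (fun m n => m < n ∧ ε / 4 ≤ dist (b (s n)) (a (s m)) ∧ ε / 4 ≤ dist (a (s n)) (b (s m))) (by
      intro W _
      have h1 : ∀ᶠ n in atTop, ∀ m ∈ W,
          m < n ∧ ε / 4 ≤ dist (b (s n)) (a (s m)) ∧ ε / 4 ≤ dist (a (s n)) (b (s m)) := by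
        rw [Finset.eventually_all]
        intro m _
        filter_upwards [eventually_gt_atTop m, hfar (a (s m)), hfar (b (s m))] with n h1 h2 h3
        exact ⟨h1, h2.2, h3.1⟩
      obtain ⟨n, hn⟩ := h1.exists
      exact ⟨n, trivial, hn⟩)
  have htm : StrictMono t := fun m n hmn => (ht m n hmn).1
  have hsep : ∀ m n, ε / 4 ≤ dist (b (s (t n))) (a (s (t m))) := by
    intro m n
    rcases lt_trichotomy m n with hmn | rfl | hmn
    · exact (ht m n hmn).2.1
    · rw [dist_comm]
      have := hsε (t m)
      linarith
    · rw [dist_comm]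
      exact (ht n m hmn).2.2
  set A : Set Z := range fun m => a (s (t m))
  have hA0 : A.Nonempty := range_nonempty _
  have hUC : (fun z => min (Metric.infDist z A) ε) ∈ UC Z :=
    UC.min_const (Metric.uniformContinuous_infDist_pt A) (fun _ => Metric.infDist_nonneg) hε.le
  obtain ⟨n, hn⟩ := (htm.tendsto_atTop.eventually (hsub _ hUC (ε / 4) (by positivity))).exists
  have h1 : Metric.infDist (a (s (t n))) A = 0 := Metric.infDist_zero_of_mem ⟨n, rfl⟩
  have h2 : ε / 4 ≤ Metric.infDist (b (s (t n))) A := by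
    rw [Metric.le_infDist hA0]
    rintro _ ⟨m, rfl⟩
    exact hsep m n
  have h3 : ε / 4 ≤ min (Metric.infDist (b (s (t n))) A) ε := le_min h2 (by linarith)
  rw [h1, min_eq_left hε.le, abs_lt] at hn
  linarith

theorem exists_tendsto_of_UC [CompleteSpace Z] {u : ℕ → Z}
    (h : ∀ f ∈ UC Z, ∃ l, Tendsto (fun n => f (u n)) atTop (𝓝 l)) :
    ∃ z, Tendsto u atTop (𝓝 z) := by
  refine cauchySeq_tendsto_of_complete (Metric.cauchySeq_iff.2 ?_)
  by_contra! hcon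
  obtain ⟨ε, hε, hcon⟩ := hcon
  choose m hm n hn hmn using hcon
  have hm' : Tendsto m atTop atTop := tendsto_atTop_mono hm tendsto_id
  have hn' : Tendsto n atTop atTop := tendsto_atTop_mono hn tendsto_id
  have := tendsto_dist_of_UC (a := fun k => u (m k)) (b := fun k => u (n k)) (by
    intro f hf
    obtain ⟨l, hl⟩ := h f hf
    simpa using (hl.comp hm').sub (hl.comp hn'))
  obtain ⟨k, hk⟩ := (this.eventually (gt_mem_nhds hε)).exists
  exact absurd (hmn k) (not_le.2 hk)

theorem uniformContinuous_of_comp_UC {W : Type*} [MetricSpace W] {φ : W → Z}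
    (h : ∀ f ∈ UC Z, UniformContinuous fun w => f (φ w)) : UniformContinuous φ := by
  rw [Metric.uniformContinuous_iff]
  by_contra! hcon
  obtain ⟨ε, hε, hcon⟩ := hcon
  choose a b hab hε' using fun n : ℕ => hcon (1 / ((n : ℝ) + 1)) (by positivity)
  have hab0 : Tendsto (fun n => dist (a n) (b n)) atTop (𝓝 0) :=
    squeeze_zero (fun _ => dist_nonneg) (fun n => (hab n).le) tendsto_one_div_add_atTop_nhds_zero_nat
  have := tendsto_dist_of_UC (a := fun n => φ (a n)) (b := fun n => φ (b n)) (by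
    intro f hf
    rw [Metric.tendsto_nhds]
    intro δ hδ
    obtain ⟨η, hη, hf'⟩ := Metric.uniformContinuous_iff.1 (h f hf) δ hδ
    filter_upwards [hab0.eventually (gt_mem_nhds hη)] with n hn
    simpa [Real.dist_eq] using hf' hn)
  obtain ⟨k, hk⟩ := (this.eventually (gt_mem_nhds hε)).exists
  exact absurd (hε' k) (not_le.2 hk)

/-- If `|f (u n) - f (v n)|` converges for all `f ∈ UC Z`, not always to `0`, then the unordered
pairs `{u n, v n}` converge. -/
theorem exists_tendsto_pair [CompleteSpace Z] {u v : ℕ → Z}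
    (h : ∀ f ∈ UC Z, ∃ l, Tendsto (fun n => |f (u n) - f (v n)|) atTop (𝓝 l))
    {g : Z → ℝ} (hg : g ∈ UC Z) {c : ℝ} (hc : c ≠ 0)
    (hgc : Tendsto (fun n => |g (u n) - g (v n)|) atTop (𝓝 c)) :
    ∃ (u' v' : ℕ → Z) (p q : Z), (∀ n, u' n = u n ∧ v' n = v n ∨ u' n = v n ∧ v' n = u n) ∧
      Tendsto u' atTop (𝓝 p) ∧ Tendsto v' atTop (𝓝 q) := by
  have horient : ∀ n, ∃ a b, (a = u n ∧ b = v n ∨ a = v n ∧ b = u n) ∧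
      g a - g b = |g (u n) - g (v n)| := by
    intro n
    rcases le_total (g (v n)) (g (u n)) with hle | hle
    · exact ⟨u n, v n, Or.inl ⟨rfl, rfl⟩, (abs_of_nonneg (sub_nonneg.2 hle)).symm⟩
    · exact ⟨v n, u n, Or.inr ⟨rfl, rfl⟩,
        by rw [abs_sub_comm, abs_of_nonneg (sub_nonneg.2 hle)]⟩
  choose u' v' hswap hgabs using horient
  have hg' : Tendsto (fun n => g (u' n) - g (v' n)) atTop (𝓝 c) := by
    simpa only [hgabs] using hgc
  have hsq : ∀ f ∈ UC Z, ∃ l, Tendsto (fun n => (f (u' n) - f (v' n)) ^ 2) atTop (𝓝 l) := by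
    intro f hf
    obtain ⟨l, hl⟩ := h f hf
    refine ⟨l ^ 2, (hl.pow 2).congr fun n => ?_⟩
    rw [sq_abs]
    rcases hswap n with ⟨h1, h2⟩ | ⟨h1, h2⟩ <;> rw [h1, h2]
    ring
  have hdiff : ∀ f ∈ UC Z, ∃ l, Tendsto (fun n => f (u' n) - f (v' n)) atTop (𝓝 l) := by
    intro f hf
    obtain ⟨l₁, h₁⟩ := hsq f hf
    obtain ⟨l₂, h₂⟩ := hsq _ (UC.add hf hg)
    refine ⟨(l₂ - l₁ - c ^ 2) / 2 / c,
      ((((h₂.sub h₁).sub (hg'.pow 2)).div_const 2).div hg' hc).congr' ?_⟩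
    filter_upwards [hg'.eventually_ne hc] with n hn
    simp only [Pi.div_apply]
    rw [div_eq_iff hn]
    ring
  have hval : ∀ f ∈ UC Z, ∀ l ≠ 0, Tendsto (fun n => f (u' n) - f (v' n)) atTop (𝓝 l) →
      (∃ k, Tendsto (fun n => f (u' n)) atTop (𝓝 k)) ∧
      ∃ k, Tendsto (fun n => f (v' n)) atTop (𝓝 k) := by
    intro f hf l hl hfl
    obtain ⟨k, hk⟩ := hdiff _ (UC.sq hf)
    have hsum : Tendsto (fun n => f (u' n) + f (v' n)) atTop (𝓝 (k / l)) := by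
      refine (hk.div hfl hl).congr' ?_
      filter_upwards [hfl.eventually_ne hl] with n hn
      simp only [Pi.div_apply]
      rw [div_eq_iff hn]
      ring
    exact ⟨⟨_, ((hsum.add hfl).div_const 2).congr fun n => by ring⟩,
      ⟨_, ((hsum.sub hfl).div_const 2).congr fun n => by ring⟩⟩
  have hall : ∀ f ∈ UC Z, (∃ k, Tendsto (fun n => f (u' n)) atTop (𝓝 k)) ∧
      ∃ k, Tendsto (fun n => f (v' n)) atTop (𝓝 k) := by
    intro f hf
    obtain ⟨l, hl⟩ := hdiff f hf
    by_cases h0 : l = 0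
    · subst h0
      obtain ⟨⟨k₁, h₁⟩, k₂, h₂⟩ := hval _ (UC.add hf hg) c hc
        (by simpa only [zero_add, add_sub_add_comm] using hl.add hg')
      obtain ⟨⟨m₁, g₁⟩, m₂, g₂⟩ := hval g hg c hc hg'
      exact ⟨⟨_, (h₁.sub g₁).congr fun n => by ring⟩, ⟨_, (h₂.sub g₂).congr fun n => by ring⟩⟩
    · exact hval f hf l h0 hl
  obtain ⟨p, hp⟩ := exists_tendsto_of_UC fun f hf => (hall f hf).1
  obtain ⟨q, hq⟩ := exists_tendsto_of_UC fun f hf => (hall f hf).2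
  exact ⟨u', v', p, q, hswap, hp, hq⟩

end Functions

section Pseudometrics

variable {Z : Type*} [MetricSpace Z]

/-- The pseudometric `(a, b) ↦ |f a - f b|`. -/
def absDiff {Z : Type*} (f : Z → ℝ) (a b : Z) : ℝ := |f a - f b|

theorem IsPseudometric.nonneg {Z : Type*} {d : Z → Z → ℝ} (hd : IsPseudometric d) (z w : Z) :
    0 ≤ d z w := by
  have h := hd.2.2 z w z
  rw [hd.1, hd.2.1 w z] at h
  linarith

theorem Ucal.nonneg {d : Z → Z → ℝ} (hd : d ∈ Ucal Z) (z w : Z) : 0 ≤ d z w :=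
  hd.1.1.nonneg z w

theorem absDiff_mem_Ucal {f : Z → ℝ} (hf : f ∈ UC Z) : absDiff f ∈ Ucal Z := by
  refine ⟨⟨⟨fun z => by simp [absDiff], fun z w => abs_sub_comm _ _,
    fun z w v => abs_sub_le _ _ _⟩, ?_, ?_⟩, ?_⟩
  · obtain ⟨C, hC⟩ := hf.1
    exact ⟨C + C, fun z w => (abs_sub _ _).trans (add_le_add (hC z) (hC w))⟩
  · have := hf.2.continuous
    unfold absDiff
    fun_prop
  · intro ε hε
    exact ⟨{f}, by simp, by simpa using hf, ε, hε, fun x y h => h f (by simp)⟩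

theorem zero_mem_Ucal : (fun _ _ => 0 : Z → Z → ℝ) ∈ Ucal Z := by
  have h := absDiff_mem_Ucal (UC.const (Z := Z) 0)
  unfold absDiff at h
  simpa using h

theorem Ucal.two_mul {d : Z → Z → ℝ} (hd : d ∈ Ucal Z) : (fun a b => 2 * d a b) ∈ Ucal Z := by
  obtain ⟨⟨⟨h1, h2, h3⟩, ⟨C, hC⟩, hcont⟩, hU⟩ := hd
  refine ⟨⟨⟨fun z => by simp [h1], fun z w => congrArg (2 * ·) (h2 z w),
    fun z w v => ?_⟩, ⟨2 * C, fun z w => ?_⟩,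
    hcont.const_mul 2⟩, fun ε hε => ?_⟩
  · have := h3 z w v
    linarith
  · have := hC z w
    linarith
  · obtain ⟨F, hF, hFU, δ, hδ, h⟩ := hU (ε / 2) (by positivity)
    refine ⟨F, hF, hFU, δ, hδ, fun x y hxy => ?_⟩
    have := h x y hxy
    linarith

theorem Ucal.eventually_uniformity_lt {d : Z → Z → ℝ} (hd : d ∈ Ucal Z) {ε : ℝ} (hε : 0 < ε) :
    ∀ᶠ p in uniformity Z, d p.1 p.2 < ε := by
  obtain ⟨F, -, hF, δ, hδ, h⟩ := hd.2 ε hε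
  have : ∀ᶠ p in uniformity Z, ∀ f ∈ F, |f p.1 - f p.2| < δ := by
    rw [Finset.eventually_all]
    intro f hf
    exact (hF hf).2 (Metric.dist_mem_uniformity hδ)
  filter_upwards [this] with p hp using h _ _ hp

theorem abs_sub_le_supDist {d e : Z → Z → ℝ} (hd : d ∈ Ucal Z) (he : e ∈ Ucal Z) (z w : Z) :
    |d z w - e z w| ≤ supDist d e := by
  obtain ⟨C, hC⟩ := hd.1.2.1
  obtain ⟨D, hD⟩ := he.1.2.1
  refine le_ciSup (f := fun p : Z × Z => |d p.1 p.2 - e p.1 p.2|) ⟨C + D, ?_⟩ (z, w)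
  rintro _ ⟨p, rfl⟩
  have := hC p.1 p.2
  have := hD p.1 p.2
  have := Ucal.nonneg hd p.1 p.2
  have := Ucal.nonneg he p.1 p.2
  rw [abs_le]
  constructor <;> linarith

theorem supDist_le {Z : Type*} [Nonempty Z] {d e : Z → Z → ℝ} {C : ℝ}
    (h : ∀ z w, |d z w - e z w| ≤ C) :
    supDist d e ≤ C :=
  ciSup_le fun p => h p.1 p.2

theorem exists_lt_abs_sub {Z : Type*} [Nonempty Z] {d e : Z → Z → ℝ} {C : ℝ}
    (h : C < supDist d e) :
    ∃ z w, C < |d z w - e z w| := by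
  obtain ⟨p, hp⟩ := exists_lt_of_lt_ciSup h
  exact ⟨p.1, p.2, hp⟩

/-- Inequalities between elements of `Ucal` at finitely many pairs pass to arbitrary
functions. -/
theorem abs_sub_le_of_Ucal {p q a b c d : Z}
    (h : ∀ e ∈ Ucal Z, e p q ≤ e a b + e c d) (g : Z → ℝ) :
    |g p - g q| ≤ |g a - g b| + |g c - g d| := by
  classical
  obtain ⟨f, hf, hfg⟩ := exists_UC_eqOn_finset g {p, q, a, b, c, d}
  have := h _ (absDiff_mem_Ucal hf)
  simpa [absDiff, hfg] using this

theorem mem_of_Ucal_le {p q a b c d : Z} (hpq : p ≠ q)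
    (h : ∀ e ∈ Ucal Z, e p q ≤ e a b + e c d) : p = a ∨ p = b ∨ p = c ∨ p = d := by
  classical
  by_contra! hcon
  have := abs_sub_le_of_Ucal h (fun z => if z = p then 1 else 0)
  simp [hpq.symm, hcon.1.symm, hcon.2.1.symm, hcon.2.2.1.symm, hcon.2.2.2.symm] at this
  linarith

theorem pair_eq_of_Ucal_eq {p q a b : Z} (hpq : p ≠ q)
    (h : ∀ e ∈ Ucal Z, e p q = e a b) : p = a ∧ q = b ∨ p = b ∧ q = a := by
  have h1 := mem_of_Ucal_le (a := a) (b := b) (c := a) (d := a) hpq fun e he => by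
    rw [h e he]; linarith [Ucal.nonneg he a a]
  have h2 := mem_of_Ucal_le (a := a) (b := b) (c := a) (d := a) hpq.symm fun e he => by
    rw [he.1.1.2.1, h e he]; linarith [Ucal.nonneg he a a]
  grind

theorem exists_strong_peak {x y : Z} (hxy : x ≠ y) :
    ∃ f ∈ UC Z, absDiff f x y = 2 ∧ (∀ a b, absDiff f a b ≤ 2) ∧
      ∀ e ∈ Ucal Z, ∀ ε > 0, ∃ η > 0, ∀ a b, 2 - η ≤ absDiff f a b → |e a b - e x y| < ε := by
  have hr : 0 < dist x y := dist_pos.2 hxy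
  set r := dist x y
  have hx1 := bump_self x r
  have hy1 := bump_self y r
  have hxy0 : bump x r y = 0 := bump_eq_zero hr (dist_comm x y ▸ le_rfl)
  have hyx0 : bump y r x = 0 := bump_eq_zero hr le_rfl
  have hbx := bump_le_one x hr
  have hby := bump_le_one y hr
  have hnx := bump_nonneg x r
  have hny := bump_nonneg y r
  refine ⟨fun z => bump x r z + (-1) * bump y r z,
    UC.add (bump_mem_UC x hr) (UC.const_mul (-1) (bump_mem_UC y hr)), ?_, fun a b => ?_, ?_⟩
  · simp only [absDiff, hx1, hy1, hxy0, hyx0]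
    norm_num
  · have := hbx a; have := hbx b; have := hby a; have := hby b
    have := hnx a; have := hnx b; have := hny a; have := hny b
    rw [absDiff, abs_le]
    constructor <;> linarith
  · intro e he ε hε
    have hc : ContinuousAt (fun p : Z × Z => e p.1 p.2) (x, y) := he.1.2.2.continuousAt
    obtain ⟨δ, hδ, hball⟩ := Metric.continuousAt_iff.1 hc ε hε
    have hη : 0 < min (1 / 2) (δ / (2 * r)) := by positivity
    have hη1 : min (1 / 2) (δ / (2 * r)) < 1 := (min_le_left _ _).trans_lt (by norm_num)
    have hηδ : min (1 / 2) (δ / (2 * r)) * r < δ := by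
      calc min (1 / 2) (δ / (2 * r)) * r ≤ δ / (2 * r) * r :=
            mul_le_mul_of_nonneg_right (min_le_right _ _) hr.le
        _ = δ / 2 := by field_simp
        _ < δ := by linarith
    set η := min (1 / 2) (δ / (2 * r))
    have key : ∀ a b, 1 - η ≤ bump x r a → 1 - η ≤ bump y r b → |e a b - e x y| < ε := by
      intro a b ha hb
      have h1 := (dist_le_of_le_bump hr hη1 ha).trans_lt hηδ
      have h2 := (dist_le_of_le_bump hr hη1 hb).trans_lt hηδ
      have h3 : dist (a, b) (x, y) < δ := by
        rw [Prod.dist_eq]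
        exact max_lt h1 h2
      simpa [Real.dist_eq] using hball h3
    refine ⟨η, hη, fun a b hab => ?_⟩
    have := hbx a; have := hbx b; have := hby a; have := hby b
    have := hnx a; have := hnx b; have := hny a; have := hny b
    rcases le_abs.1 hab with h | h
    · exact key a b (by linarith) (by linarith)
    · rw [he.1.1.2.1 a b]
      exact key b a (by linarith) (by linarith)

end Pseudometrics

section Isometry

variable {X Y : Type*} [MetricSpace X] [MetricSpace Y]

/-- `T` and `S` are mutually inverse isometries between `Ucal X` and `Ucal Y`. -/
structure IsUcalIsometry (T : (X → X → ℝ) → (Y → Y → ℝ)) (S : (Y → Y → ℝ) → (X → X → ℝ)) :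
    Prop where
  mapsTo : ∀ d ∈ Ucal X, T d ∈ Ucal Y
  mapsTo_inv : ∀ e ∈ Ucal Y, S e ∈ Ucal X
  left_inv : ∀ d ∈ Ucal X, S (T d) = d
  right_inv : ∀ e ∈ Ucal Y, T (S e) = e
  supDist_eq : ∀ d ∈ Ucal X, ∀ e ∈ Ucal X, supDist (T d) (T e) = supDist d e

variable {T : (X → X → ℝ) → (Y → Y → ℝ)} {S : (Y → Y → ℝ) → (X → X → ℝ)}

theorem IsUcalIsometry.symm (h : IsUcalIsometry T S) : IsUcalIsometry S T where
  mapsTo := h.mapsTo_inv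
  mapsTo_inv := h.mapsTo
  left_inv := h.right_inv
  right_inv := h.left_inv
  supDist_eq d hd e he := by
    rw [← h.supDist_eq _ (h.mapsTo_inv d hd) _ (h.mapsTo_inv e he), h.right_inv d hd,
      h.right_inv e he]

theorem IsUcalIsometry.map_zero [Nonempty X] [Nonempty Y] (h : IsUcalIsometry T S) :
    T (fun _ _ => 0) = fun _ _ => 0 := by
  have h0X := zero_mem_Ucal (Z := X)
  have h0Y := zero_mem_Ucal (Z := Y)
  have hp := h.mapsTo _ h0X
  set p := T (fun _ _ => 0)
  have hSp : S p = fun _ _ => 0 := h.left_inv _ h0X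
  have h2p := Ucal.two_mul hp
  set N := supDist p fun _ _ => 0
  have hq : supDist (S fun _ _ => 0) (fun _ _ => 0) ≤ N := by
    rw [← hSp, h.symm.supDist_eq _ h0Y _ hp]
    refine supDist_le fun z w => ?_
    rw [abs_sub_comm]
    exact abs_sub_le_supDist hp h0Y z w
  have hr : supDist (S fun a b => 2 * p a b) (fun _ _ => 0) ≤ N := by
    rw [← hSp, h.symm.supDist_eq _ h2p _ hp]
    refine supDist_le fun z w => ?_
    have := abs_sub_le_supDist hp h0Y z w
    rwa [sub_zero, show p z w = 2 * p z w - p z w by ring] at this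
  have hqr : supDist (fun a b => 2 * p a b) (fun _ _ => 0) ≤ N := by
    rw [← h.symm.supDist_eq _ h2p _ h0Y]
    refine supDist_le fun z w => ?_
    have hq' := h.mapsTo_inv _ h0Y
    have hr' := h.mapsTo_inv _ h2p
    have h1 := (abs_sub_le_supDist hq' h0X z w).trans hq
    have h2 := (abs_sub_le_supDist hr' h0X z w).trans hr
    have h3 := Ucal.nonneg hq' z w
    have h4 := Ucal.nonneg hr' z w
    rw [sub_zero, abs_of_nonneg ‹_›] at h1 h2
    rw [abs_le]
    constructor <;> linarith
  have hhalf : N ≤ N / 2 := supDist_le fun z w => by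
    have h1 := (abs_sub_le_supDist h2p h0Y z w).trans hqr
    have h2 := Ucal.nonneg hp z w
    rw [sub_zero, abs_of_nonneg (by linarith)] at h1
    rw [sub_zero, abs_of_nonneg h2]
    linarith
  funext z w
  have h1 := abs_sub_le_supDist hp h0Y z w
  have h2 := Ucal.nonneg hp z w
  rw [sub_zero, abs_of_nonneg h2] at h1
  linarith

theorem IsUcalIsometry.exists_seq_le [Nonempty X] [Nonempty Y] (h : IsUcalIsometry T S)
    {x y : X} {f : X → ℝ} (hf : f ∈ UC X) (hfxy : absDiff f x y = 2) (hf2 : ∀ a b, absDiff f a b ≤ 2)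
    (hpeak : ∀ e ∈ Ucal X, ∀ ε > 0, ∃ η > 0, ∀ a b,
      2 - η ≤ absDiff f a b → |e a b - e x y| < ε) :
    ∃ u v : ℕ → Y, ∀ e ∈ Ucal X, ∀ ε > 0, ∀ᶠ n in atTop, e x y - ε < T e (u n) (v n) := by
  have h0X := zero_mem_Ucal (Z := X)
  have h0Y := zero_mem_Ucal (Z := Y)
  have hmem : ∀ n : ℕ, absDiff (fun z => (n : ℝ) * f z) ∈ Ucal X := fun n =>
    absDiff_mem_Ucal (UC.const_mul n hf)
  have hval : ∀ (n : ℕ) a b, absDiff (fun z => (n : ℝ) * f z) a b = n * absDiff f a b := by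
    intro n a b
    rw [absDiff, absDiff, ← mul_sub, abs_mul, Nat.abs_cast]
  have hex : ∀ n : ℕ, ∃ u v, 2 * (n : ℝ) - 1 / ((n : ℝ) + 1) <
      T (absDiff fun z => (n : ℝ) * f z) u v := by
    intro n
    have hlt : 2 * (n : ℝ) - 1 / ((n : ℝ) + 1) <
        supDist (T (absDiff fun z => (n : ℝ) * f z)) (fun _ _ => 0) := by
      rw [← h.map_zero, h.supDist_eq _ (hmem n) _ h0X]
      have h1 := abs_sub_le_supDist (hmem n) h0X x y
      rw [sub_zero, abs_of_nonneg (Ucal.nonneg (hmem n) x y), hval, hfxy] at h1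
      have : 0 < 1 / ((n : ℝ) + 1) := by positivity
      linarith
    obtain ⟨u, v, huv⟩ := exists_lt_abs_sub hlt
    rw [sub_zero, abs_of_nonneg (Ucal.nonneg (h.mapsTo _ (hmem n)) u v)] at huv
    exact ⟨u, v, huv⟩
  choose u v huv using hex
  refine ⟨u, v, fun e he ε hε => ?_⟩
  obtain ⟨η, hη, hpk⟩ := hpeak e he (ε / 2) (by positivity)
  obtain ⟨C, hC⟩ := he.1.2.1
  have hC0 : 0 ≤ C := (Ucal.nonneg he x y).trans (hC x y)
  have hlim : Tendsto (fun n : ℕ => (n : ℝ) * η) atTop atTop :=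
    tendsto_natCast_atTop_atTop.atTop_mul_const hη
  filter_upwards [hlim.eventually_ge_atTop C,
    (tendsto_natCast_atTop_atTop (R := ℝ)).eventually_ge_atTop C,
    (tendsto_one_div_add_atTop_nhds_zero_nat (𝕜 := ℝ)).eventually
      (gt_mem_nhds (half_pos hε))] with n hn1 hn2 hn3
  have hdist : supDist (absDiff fun z => (n : ℝ) * f z) e ≤ 2 * n - e x y + ε / 2 := by
    refine supDist_le fun a b => ?_
    rw [hval]
    have hfab := hf2 a b
    have hfab0 : 0 ≤ absDiff f a b := abs_nonneg _
    have he0 := Ucal.nonneg he a b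
    have h1 := hC a b
    have h2 := hC x y
    have hn0 : (0 : ℝ) ≤ n := n.cast_nonneg
    rw [abs_le]
    constructor
    · nlinarith [mul_nonneg hn0 hfab0]
    · rcases le_or_gt (2 - η) (absDiff f a b) with hab | hab
      · have := (abs_lt.1 (hpk a b hab)).1
        nlinarith
      · nlinarith
  have h1 := abs_sub_le_supDist (h.mapsTo _ (hmem n)) (h.mapsTo _ he) (u n) (v n)
  rw [h.supDist_eq _ (hmem n) _ he] at h1
  have h2 := (abs_le.1 (h1.trans hdist)).2
  have h3 := huv n
  linarith

/-- The pair `(x, y)` in `X` corresponds to the pair `(u, v)` in `Y` under `T`. -/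
def Corr {Y : Type*} (T : (X → X → ℝ) → (Y → Y → ℝ)) (x y : X) (u v : Y) : Prop :=
  ∀ e ∈ Ucal X, T e u v = e x y

theorem IsUcalIsometry.exists_corr [CompleteSpace Y] [Nonempty X] [Nonempty Y]
    (h : IsUcalIsometry T S) {x y : X} (hxy : x ≠ y) : ∃ u v, Corr T x y u v := by
  obtain ⟨f, hf, hfxy, hf2, hpeak⟩ := exists_strong_peak hxy
  obtain ⟨u, v, huv⟩ := h.exists_seq_le hf hfxy hf2 hpeak
  have hfU := absDiff_mem_Ucal hf
  have hlim : ∀ e ∈ Ucal X, Tendsto (fun n => T e (u n) (v n)) atTop (𝓝 (e x y)) := by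
    intro e he
    rw [Metric.tendsto_nhds]
    intro ε hε
    obtain ⟨η, hη, hpk⟩ := hpeak e he (ε / 2) (by positivity)
    filter_upwards [huv e he ε hε, huv _ hfU (min (η / 2) 1) (by positivity)] with n hn1 hn2
    have hη1 : min (η / 2) 1 ≤ η / 2 := min_le_left _ _
    have hη2 : min (η / 2) 1 ≤ 1 := min_le_right _ _
    have hne : u n ≠ v n := by
      intro heq
      rw [heq, (h.mapsTo _ hfU).1.1.1, hfxy] at hn2
      linarith
    obtain ⟨g, hg, hguv, hg2, hgpeak⟩ := exists_strong_peak hne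
    obtain ⟨a, b, hab⟩ := h.symm.exists_seq_le hg hguv hg2 hgpeak
    obtain ⟨k, hk1, hk2⟩ := ((hab _ (h.mapsTo _ he) (ε / 2) (by positivity)).and
      (hab _ (h.mapsTo _ hfU) (η / 2) (by positivity))).exists
    rw [h.left_inv _ he] at hk1
    rw [h.left_inv _ hfU] at hk2
    rw [hfxy] at hn2
    have h1 := (abs_lt.1 (hpk (a k) (b k) (by linarith))).2
    rw [Real.dist_eq, abs_lt]
    constructor <;> linarith
  have hlim' : ∀ e ∈ Ucal Y, Tendsto (fun n => e (u n) (v n)) atTop (𝓝 (S e x y)) := by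
    intro e he
    simpa only [h.right_inv e he] using hlim _ (h.mapsTo_inv e he)
  obtain ⟨g, hg, hgne⟩ : ∃ g ∈ UC Y, S (absDiff g) x y ≠ 0 := by
    by_contra! hcon
    obtain ⟨F, -, hF, δ, hδ, hFδ⟩ := (h.mapsTo _ hfU).2 1 one_pos
    have hev : ∀ᶠ n in atTop, ∀ g ∈ F, |g (u n) - g (v n)| < δ := by
      rw [Finset.eventually_all]
      intro g hg
      have := hlim' _ (absDiff_mem_Ucal (hF hg))
      rw [hcon g (hF hg)] at this
      exact this.eventually (gt_mem_nhds hδ)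
    obtain ⟨n, hn1, hn2⟩ := (hev.and (huv _ hfU 1 one_pos)).exists
    have := hFδ _ _ hn1
    rw [hfxy] at hn2
    linarith
  obtain ⟨u', v', p, q, hswap, hp, hq⟩ := exists_tendsto_pair
    (fun k hk => ⟨_, hlim' _ (absDiff_mem_Ucal hk)⟩) hg hgne (hlim' _ (absDiff_mem_Ucal hg))
  refine ⟨p, q, fun e he => ?_⟩
  have hTe := h.mapsTo e he
  have h1 : Tendsto (fun n => T e (u' n) (v' n)) atTop (𝓝 (T e p q)) :=
    (hTe.1.2.2.tendsto (p, q)).comp (hp.prodMk_nhds hq)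
  refine tendsto_nhds_unique h1 ((hlim e he).congr fun n => ?_)
  rcases hswap n with ⟨h2, h3⟩ | ⟨h2, h3⟩ <;> rw [h2, h3]
  exact hTe.1.1.2.1 _ _

theorem Corr.swap (h : IsUcalIsometry T S) {x y : X} {u v : Y} (hc : Corr T x y u v) :
    Corr T y x v u := fun e he => by
  rw [(h.mapsTo e he).1.1.2.1, hc e he, he.1.1.2.1]

theorem Corr.swap_left {Y : Type*} {T : (X → X → ℝ) → (Y → Y → ℝ)} {x y : X} {u v : Y} (hc : Corr T x y u v) :
    Corr T y x u v := fun e he => by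
  rw [hc e he, he.1.1.2.1]

theorem Corr.inv (h : IsUcalIsometry T S) {x y : X} {u v : Y} (hc : Corr T x y u v) :
    Corr S u v x y := fun e he => by
  rw [← hc _ (h.mapsTo_inv e he), h.right_inv e he]

theorem Corr.ne (h : IsUcalIsometry T S) {x y : X} {u v : Y} (hc : Corr T x y u v)
    (hxy : x ≠ y) : u ≠ v := by
  rintro rfl
  obtain ⟨f, hf, hfxy, -⟩ := exists_strong_peak hxy
  have hfU := absDiff_mem_Ucal hf
  have := hc _ hfU
  rw [(h.mapsTo _ hfU).1.1.1, hfxy] at this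
  norm_num at this

theorem Corr.left_unique {Y : Type*} {T : (X → X → ℝ) → (Y → Y → ℝ)} {x y x' y' : X} {u v : Y}
    (hc : Corr T x y u v)
    (hc' : Corr T x' y' u v) (hxy : x ≠ y) : x = x' ∧ y = y' ∨ x = y' ∧ y = x' :=
  pair_eq_of_Ucal_eq hxy fun e he => by rw [← hc e he, ← hc' e he]

theorem Corr.right_unique (h : IsUcalIsometry T S) {x y : X} {u v u' v' : Y}
    (hc : Corr T x y u v) (hc' : Corr T x y u' v') (hxy : x ≠ y) :
    u = u' ∧ v = v' ∨ u = v' ∧ v = u' :=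
  (hc.inv h).left_unique (hc'.inv h) (hc.ne h hxy)

/-- Sides of a triangle in `X` correspond to sides of a triangle in `Y`. -/
theorem IsUcalIsometry.corr_triangle [CompleteSpace Y] [Nonempty X] [Nonempty Y]
    (h : IsUcalIsometry T S) {x y z : X} (hxy : x ≠ y) (hyz : y ≠ z) (hxz : x ≠ z)
    {a b : Y} (hab : Corr T x y a b) :
    (∃ c, Corr T y z b c ∧ Corr T x z a c) ∨ ∃ c, Corr T y z a c ∧ Corr T x z b c := by
  obtain ⟨c, d, hcd⟩ := h.exists_corr hyz
  obtain ⟨p, q, hpq⟩ := h.exists_corr hxz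
  have hne1 := hab.ne h hxy
  have hne2 := hcd.ne h hyz
  have hne3 := hpq.ne h hxz
  have hval : ∀ {s t : X} {k l : Y}, Corr T s t k l → ∀ e ∈ Ucal Y, e k l = S e s t :=
    fun hc e he => ((hc.inv h) e he).symm
  have t1 : ∀ e ∈ Ucal Y, e a b ≤ e c d + e p q := fun e he => by
    rw [hval hab e he, hval hcd e he, hval hpq e he]
    have hS := (h.mapsTo_inv e he).1.1
    have := hS.2.2 x z y
    rw [hS.2.1 z y] at this
    linarith
  have t2 : ∀ e ∈ Ucal Y, e c d ≤ e a b + e p q := fun e he => by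
    rw [hval hab e he, hval hcd e he, hval hpq e he]
    have hS := (h.mapsTo_inv e he).1.1
    have := hS.2.2 y x z
    rw [hS.2.1 y x] at this
    linarith
  have t3 : ∀ e ∈ Ucal Y, e p q ≤ e a b + e c d := fun e he => by
    rw [hval hab e he, hval hcd e he, hval hpq e he]
    exact (h.mapsTo_inv e he).1.1.2.2 x y z
  have flip : ∀ {k l m n r s : Y}, (∀ e ∈ Ucal Y, e k l ≤ e m n + e r s) →
      ∀ e ∈ Ucal Y, e l k ≤ e m n + e r s := fun hk e he => by
    rw [he.1.1.2.1]
    exact hk e he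
  have ha := mem_of_Ucal_le hne1 t1
  have hb := mem_of_Ucal_le hne1.symm (flip t1)
  have hc := mem_of_Ucal_le hne2 t2
  have hd := mem_of_Ucal_le hne2.symm (flip t2)
  have hp := mem_of_Ucal_le hne3 t3
  have hq := mem_of_Ucal_le hne3.symm (flip t3)
  have swapR : ∀ {s t : X} {k l : Y}, Corr T s t k l → Corr T s t l k :=
    fun hc => (hc.swap h).swap_left
  have hdc := swapR hcd
  have hqp := swapR hpq
  have n1 : ¬ Corr T y z a b := fun hc => by
    have := hab.left_unique hc hxy
    grind
  have n2 : ¬ Corr T x z a b := fun hc => by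
    have := hab.left_unique hc hxy
    grind
  have n3 : ¬ Corr T y z p q := fun hc => by
    have := hpq.left_unique hc hxz
    grind
  have n1' : ¬ Corr T y z b a := fun hc => n1 (swapR hc)
  have n2' : ¬ Corr T x z b a := fun hc => n2 (swapR hc)
  have n3' : ¬ Corr T y z q p := fun hc => n3 (swapR hc)
  clear t1 t2 t3 flip hval swapR hab h
  grind

theorem IsUcalIsometry.exists_vertex [CompleteSpace Y] [Nontrivial X] [Nonempty Y]
    (h : IsUcalIsometry T S) (y : X) : ∃ b, ∀ w, w ≠ y → ∃ c, Corr T y w b c := by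
  have swapR : ∀ {s t : X} {k l : Y}, Corr T s t k l → Corr T s t l k :=
    fun hc => (hc.swap h).swap_left
  obtain ⟨x, hxy⟩ := exists_ne y
  obtain ⟨a₀, b₀, hab₀⟩ := h.exists_corr hxy
  by_cases hz : ∃ z, z ≠ x ∧ z ≠ y
  · obtain ⟨z, hzx, hzy⟩ := hz
    obtain ⟨a, b, c, hab, hbc, hac⟩ : ∃ a b c, Corr T x y a b ∧ Corr T y z b c ∧ Corr T x z a c := by
      rcases h.corr_triangle hxy hzy.symm hzx.symm hab₀ with ⟨c, h1, h2⟩ | ⟨c, h1, h2⟩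
      · exact ⟨a₀, b₀, c, hab₀, h1, h2⟩
      · exact ⟨b₀, a₀, c, swapR hab₀, h1, h2⟩
    refine ⟨b, fun w hw => ?_⟩
    by_cases hwx : w = x
    · subst hwx
      exact ⟨a, hab.swap h⟩
    by_cases hwz : w = z
    · subst hwz
      exact ⟨c, hbc⟩
    rcases h.corr_triangle hxy hw.symm (Ne.symm hwx) hab with ⟨c', h1, -⟩ | ⟨c', h1, -⟩
    · exact ⟨c', h1⟩
    rcases h.corr_triangle hzy hw.symm (Ne.symm hwz) (hbc.swap h) with ⟨c'', h2, -⟩ | ⟨c'', h2, -⟩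
    · exact ⟨c'', h2⟩
    exfalso
    have hac' := hac.ne h hzx.symm
    rcases h1.right_unique h h2 hw.symm with ⟨h3, -⟩ | ⟨-, h4⟩
    · exact hac' h3
    · rw [h4] at h1
      have := hac.left_unique h1 hzx.symm
      grind
  · push Not at hz
    refine ⟨b₀, fun w hw => ⟨a₀, ?_⟩⟩
    have : w = x := by
      by_contra hwx
      exact hw (hz w hwx)
    subst this
    exact hab₀.swap h

theorem IsUcalIsometry.exists_map [CompleteSpace Y] [Nontrivial X] [Nonempty Y]
    (h : IsUcalIsometry T S) : ∃ ψ : X → Y, ∀ x y, x ≠ y → Corr T x y (ψ x) (ψ y) := by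
  classical
  have swapR : ∀ {s t : X} {k l : Y}, Corr T s t k l → Corr T s t l k :=
    fun hc => (hc.swap h).swap_left
  by_cases h3 : ∀ x y : X, x ≠ y → ∃ z, z ≠ x ∧ z ≠ y
  · choose ψ hψ using h.exists_vertex
    refine ⟨ψ, fun x y hxy => ?_⟩
    obtain ⟨c, hc⟩ := hψ x y hxy.symm
    obtain ⟨c', hc'⟩ := hψ y x hxy
    rcases hc.right_unique h hc'.swap_left hxy with ⟨h1, -⟩ | ⟨-, h2⟩
    · exfalso
      obtain ⟨z, hzx, hzy⟩ := h3 x y hxy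
      obtain ⟨k₁, hk₁⟩ := hψ x z hzx
      obtain ⟨k₂, hk₂⟩ := hψ y z hzy
      have n1 := hc.ne h hxy
      rcases h.corr_triangle hxy hzy.symm hzx.symm hc with ⟨k, h4, h5⟩ | ⟨k, h4, h5⟩
      · have n2 := h4.ne h hzy.symm
        have n3 := h5.ne h hzx.symm
        have := h5.right_unique h hk₁ hzx.symm
        have := h4.right_unique h hk₂ hzy.symm
        grind
      · have n2 := h4.ne h hzy.symm
        have n3 := h5.ne h hzx.symm
        have := h5.right_unique h hk₁ hzx.symm
        have := h4.right_unique h hk₂ hzy.symm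
        grind
    · rwa [h2] at hc
  · push Not at h3
    obtain ⟨x, y, hxy, hz⟩ := h3
    obtain ⟨a, b, hab⟩ := h.exists_corr hxy
    refine ⟨fun z => if z = x then a else b, fun s t hst => ?_⟩
    by_cases hs : s = x
    · have ht : t = y := hz t fun h => hst (hs.trans h.symm)
      subst hs ht
      simpa [hst.symm] using hab
    · have hs' := hz s hs
      have ht : t = x := by
        by_contra ht
        exact hst (hs'.trans (hz t ht).symm)
      subst hs' ht
      simpa [hst] using hab.swap h

theorem IsUcalIsometry.uniformContinuous (h : IsUcalIsometry T S) {φ : Y → X}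
    (hφ : ∀ d ∈ Ucal X, ∀ u v, T d u v = d (φ u) (φ v)) : UniformContinuous φ := by
  refine uniformContinuous_of_comp_UC fun f hf => ?_
  have hfU := absDiff_mem_Ucal hf
  refine Metric.uniformity_basis_dist.tendsto_right_iff.2 fun ε hε => ?_
  filter_upwards [Ucal.eventually_uniformity_lt (h.mapsTo _ hfU) hε] with p hp
  rw [hφ _ hfU] at hp
  exact hp

end Isometry

theorem stmt5 {X Y : Type*} [MetricSpace X] [MetricSpace Y]
    [CompleteSpace X] [CompleteSpace Y] [Nontrivial X] [Nontrivial Y]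
    (T : (X → X → ℝ) → (Y → Y → ℝ))
    (hbij : Set.BijOn T (Ucal X) (Ucal Y))
    (hiso : ∀ d ∈ Ucal X, ∀ e ∈ Ucal X, supDist (T d) (T e) = supDist d e) :
    ∃ φ : Y ≃ X, UniformContinuous φ ∧ UniformContinuous φ.symm ∧
      ∀ d ∈ Ucal X, ∀ x y : Y, T d x y = d (φ x) (φ y) := by
  have hinv := hbij.invOn_invFunOn
  have h : IsUcalIsometry T (Function.invFunOn T (Ucal X)) :=
    ⟨fun d hd => hbij.mapsTo hd, fun e he => hbij.surjOn.mapsTo_invFunOn he,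
      fun d hd => hinv.1 hd, fun e he => hinv.2 he, hiso⟩
  obtain ⟨ψ, hψ⟩ := h.exists_map
  have hbijψ : Function.Bijective ψ := by
    constructor
    · intro x y hxy
      by_contra hne
      exact (hψ x y hne).ne h hne hxy
    · intro v
      obtain ⟨v', hv⟩ := exists_ne v
      obtain ⟨x, y, hc⟩ := h.symm.exists_corr hv
      have hxy := hc.ne h.symm hv
      rcases (hc.inv h.symm).right_unique h (hψ x y hxy) hxy with ⟨-, h2⟩ | ⟨-, h2⟩
      · exact ⟨y, h2.symm⟩
      · exact ⟨x, h2.symm⟩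
  have hT : ∀ d ∈ Ucal X, ∀ x y, T d (ψ x) (ψ y) = d x y := by
    intro d hd x y
    by_cases hxy : x = y
    · subst hxy
      rw [(h.mapsTo d hd).1.1.1, hd.1.1.1]
    · exact hψ x y hxy d hd
  set E := Equiv.ofBijective ψ hbijψ
  have hφ : ∀ d ∈ Ucal X, ∀ u v, T d u v = d (E.symm u) (E.symm v) := by
    intro d hd u v
    rw [← hT d hd (E.symm u), show ψ (E.symm u) = u from E.apply_symm_apply u,
      show ψ (E.symm v) = v from E.apply_symm_apply v]
  refine ⟨E.symm, h.uniformContinuous hφ, h.symm.uniformContinuous fun e he x y => ?_, hφ⟩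
  rw [← hT _ (h.mapsTo_inv e he), h.right_inv e he]
  rfl

end BanachStone
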